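/- Let d ≥ 1 and n ≥ 3, and let v_1, …, v_n be n distinct unit vectors in ℝ^{d+1}. Then there exists a unique a ∈ ℝ^{d+1} with ‖a‖ < 1 such that ∑_{j=1}^{n} τ_a(v_j) = 0, where τ_a is the Möbius transformation of the unit sphere defined below. (This expresses that every finite set of at least three points in the sphere can be moved by a Möbius transformation so that its barycenter is the center of the sphere, uniquely up to post-composition with an isometry of the sphere.) -/

import Mathlib

open scoped RealInnerProductSpace

/-- The Möbius transformation of the unit sphere `S^d ⊂ ℝ^{d+1}` induced by the hyperbolic
translation of the Poincaré unit ball with parameter `a`, `‖a‖ < 1`: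
`τ_a(x) = ((2 + 2⟨a,x⟩) a + (1 − ‖a‖²) x) / (1 + 2⟨a,x⟩ + ‖a‖²)`. -/
noncomputable def tau {d : ℕ} (a x : EuclideanSpace ℝ (Fin (d + 1))) :
    EuclideanSpace ℝ (Fin (d + 1)) :=
  (1 / (1 + 2 * ⟪a, x⟫ + ‖a‖ ^ 2)) • ((2 + 2 * ⟪a, x⟫) • a + (1 - ‖a‖ ^ 2) • x)

section aux

variable {E : Type*} [NormedAddCommGroup E] [InnerProductSpace ℝ E]

/-- The squared norm of `a + x` for a unit vector `x`. -/
noncomputable def den (a x : E) : ℝ := 1 + 2 * ⟪a, x⟫ + ‖a‖ ^ 2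

theorem den_eq (a x : E) (hx : ‖x‖ = 1) : den a x = ‖a + x‖ ^ 2 := by
  rw [@norm_add_sq_real, hx, den]; ring

theorem le_norm_add (a x : E) (hx : ‖x‖ = 1) : 1 - ‖a‖ ≤ ‖a + x‖ := by
  have := norm_sub_norm_le x (-a)
  rw [norm_neg, hx, sub_neg_eq_add, add_comm x a] at this
  exact this

theorem den_pos (a x : E) (hx : ‖x‖ = 1) (ha : ‖a‖ < 1) : 0 < den a x := by
  rw [den_eq a x hx]
  have := le_norm_add a x hx
  have : 0 < ‖a + x‖ := by linarith
  positivity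

theorem inner_num (a x u : E) (D : ℝ) :
    ⟪(1 / D) • ((2 + 2 * ⟪a, x⟫) • a + (1 - ‖a‖ ^ 2) • x), u⟫ =
      ((2 + 2 * ⟪a, x⟫) * ⟪a, u⟫ + (1 - ‖a‖ ^ 2) * ⟪x, u⟫) / D := by
  simp only [inner_smul_left, inner_add_left, RCLike.conj_to_real]
  ring

theorem crit_sum {n : ℕ} (v : Fin n → E) (hv : ∀ j, ‖v j‖ = 1) (a b : E) (ha : ‖a‖ < 1)
    (h : ∀ u : E, ∑ j, ((2 + 2 * ⟪a, v j⟫) * ⟪a, u⟫ + (1 - ‖a‖ ^ 2) * ⟪v j, u⟫) / den a (v j) = 0) :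
    ∑ j, (1 - ‖a‖ ^ 2) ^ 2 * den b (v j) / den a (v j) =
      n * ((1 + ‖a‖ ^ 2) * (1 + ‖b‖ ^ 2) - 4 * ⟪a, b⟫) := by
  have hA : 0 < 1 - ‖a‖ ^ 2 := by nlinarith [norm_nonneg a]
  have h1 := h a
  have h2 := h b
  rw [real_inner_self_eq_norm_sq] at h1
  set s := ‖a‖ ^ 2 with hs
  set S := ∑ j, 1 / den a (v j) with hS
  have e1 : ∑ j, ((2 + 2 * ⟪a, v j⟫) * s + (1 - s) * ⟪v j, a⟫) / den a (v j)
      = n * (1 + s) / 2 - (1 - s) ^ 2 / 2 * S := by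
    have : (n : ℝ) * (1 + s) / 2 = ∑ j : Fin n, (1 + s) / 2 := by simp; ring
    rw [this, hS, Finset.mul_sum, ← Finset.sum_sub_distrib]
    refine Finset.sum_congr rfl fun j _ => ?_
    have hp := (den_pos a (v j) (hv j) ha).ne'
    rw [real_inner_comm a (v j)]
    field_simp
    rw [den, ← hs]
    ring
  have e2 : ∑ j, ((2 + 2 * ⟪a, v j⟫) * ⟪a, b⟫ + (1 - s) * ⟪v j, b⟫) / den a (v j)
      = n * ⟪a, b⟫ + (1 - s) * ⟪a, b⟫ * S + (1 - s) * ∑ j, ⟪v j, b⟫ / den a (v j) := by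
    have : (n : ℝ) * ⟪a, b⟫ = ∑ j : Fin n, ⟪a, b⟫ := by simp
    rw [this, hS, Finset.mul_sum, Finset.mul_sum, ← Finset.sum_add_distrib,
      ← Finset.sum_add_distrib]
    refine Finset.sum_congr rfl fun j _ => ?_
    have hp := (den_pos a (v j) (hv j) ha).ne'
    field_simp
    rw [den, ← hs]
    ring
  have e3 : ∑ j, (1 - s) ^ 2 * den b (v j) / den a (v j)
      = (1 - s) ^ 2 * (1 + ‖b‖ ^ 2) * S + 2 * (1 - s) ^ 2 * ∑ j, ⟪v j, b⟫ / den a (v j) := by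
    rw [hS, Finset.mul_sum, Finset.mul_sum, ← Finset.sum_add_distrib]
    refine Finset.sum_congr rfl fun j _ => ?_
    rw [den, real_inner_comm (v j) b]
    ring
  rw [e1] at h1
  rw [e2] at h2
  rw [e3]
  linear_combination (-2 * (1 + ‖b‖ ^ 2) + 4 * ⟪a, b⟫) * h1 + 2 * (1 - s) * h2

theorem key_id (a b v : E) (hv : ‖v‖ = 1) (p q : ℝ) (hp : p = den a v) (hq : q = den b v) :
    2 * ((1 + ‖a‖ ^ 2) * (1 + ‖b‖ ^ 2) - 4 * ⟪a, b⟫) * p * q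
      - (1 - ‖a‖ ^ 2) ^ 2 * q ^ 2 - (1 - ‖b‖ ^ 2) ^ 2 * p ^ 2 =
    ‖(2 * q) • a - (2 * p) • b + (q * (1 + ‖a‖ ^ 2) - p * (1 + ‖b‖ ^ 2)) • v‖ ^ 2 := by
  rw [@norm_add_sq_real, @norm_sub_sq_real]
  simp only [inner_smul_left, inner_smul_right, inner_sub_left, RCLike.conj_to_real, norm_smul,
    mul_pow, Real.norm_eq_abs, sq_abs, hv]
  have h1 : ⟪a, v⟫ = (p - 1 - ‖a‖ ^ 2) / 2 := by rw [hp, den]; ring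
  have h2 : ⟪b, v⟫ = (q - 1 - ‖b‖ ^ 2) / 2 := by rw [hq, den]; ring
  rw [h1, h2]
  ring

theorem pigeon (A B K x y z : ℝ) (hA : A ≠ 0) (hx : A * x ^ 2 + B = K * x)
    (hy : A * y ^ 2 + B = K * y) (hz : A * z ^ 2 + B = K * z) : x = y ∨ x = z ∨ y = z := by
  by_contra! hne
  obtain ⟨h1, h2, h3⟩ := hne
  have e1 : A * (x + y) = K := by
    apply mul_left_cancel₀ (sub_ne_zero.2 h1); linear_combination hx - hy
  have e2 : A * (x + z) = K := by
    apply mul_left_cancel₀ (sub_ne_zero.2 h2); linear_combination hx - hz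
  apply h3
  apply mul_left_cancel₀ hA; linear_combination e1 - e2

theorem uniq {n : ℕ} (hn : 3 ≤ n) (v : Fin n → E) (hv : ∀ j, ‖v j‖ = 1)
    (hinj : Function.Injective v) (a b : E) (ha : ‖a‖ < 1) (hb : ‖b‖ < 1)
    (h : ∀ u : E, ∑ j, ((2 + 2 * ⟪a, v j⟫) * ⟪a, u⟫ + (1 - ‖a‖ ^ 2) * ⟪v j, u⟫) / den a (v j) = 0)
    (h' : ∀ u : E, ∑ j, ((2 + 2 * ⟪b, v j⟫) * ⟪b, u⟫ + (1 - ‖b‖ ^ 2) * ⟪v j, u⟫) / den b (v j) = 0) :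
    a = b := by
  have hA : 0 < 1 - ‖a‖ ^ 2 := by nlinarith [norm_nonneg a]
  have c1 := crit_sum v hv a b ha h
  have c2 := crit_sum v hv b a hb h'
  rw [real_inner_comm] at c2
  set K := (1 + ‖a‖ ^ 2) * (1 + ‖b‖ ^ 2) - 4 * ⟪a, b⟫ with hK
  have hp := fun j => den_pos a (v j) (hv j) ha
  have hq := fun j => den_pos b (v j) (hv j) hb
  let w := fun j => (2 * den b (v j)) • a - (2 * den a (v j)) • b
      + (den b (v j) * (1 + ‖a‖ ^ 2) - den a (v j) * (1 + ‖b‖ ^ 2)) • v j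
  have id1 : ∀ j, 2 * K * den a (v j) * den b (v j) - (1 - ‖a‖ ^ 2) ^ 2 * den b (v j) ^ 2
      - (1 - ‖b‖ ^ 2) ^ 2 * den a (v j) ^ 2 = ‖w j‖ ^ 2 :=
    fun j => key_id a b (v j) (hv j) _ _ rfl rfl
  have hsum : ∑ j, ‖w j‖ ^ 2 / (den a (v j) * den b (v j)) = 0 := by
    have : ∀ j, ‖w j‖ ^ 2 / (den a (v j) * den b (v j)) = 2 * K
        - (1 - ‖a‖ ^ 2) ^ 2 * den b (v j) / den a (v j)
        - (1 - ‖b‖ ^ 2) ^ 2 * den a (v j) / den b (v j) := by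
      intro j
      rw [← id1 j]
      have := (hp j).ne'
      have := (hq j).ne'
      field_simp
    simp_rw [this]
    rw [Finset.sum_sub_distrib, Finset.sum_sub_distrib, c1, c2]
    simp
    rw [hK]
    ring
  have hw : ∀ j, ‖w j‖ ^ 2 = 0 := by
    intro j
    have := (Finset.sum_eq_zero_iff_of_nonneg (fun j _ => by
      have := hp j; have := hq j; positivity)).1 hsum j (Finset.mem_univ j)
    have h3 := (mul_pos (hp j) (hq j)).ne'
    rcases div_eq_zero_iff.1 this with h | h
    · exact h
    · exact absurd h h3
  let r := fun j => den b (v j) / den a (v j)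
  have hr : ∀ j, (1 - ‖a‖ ^ 2) ^ 2 * r j ^ 2 + (1 - ‖b‖ ^ 2) ^ 2 = (2 * K) * r j := by
    intro j
    have h3 := id1 j
    rw [hw j] at h3
    have := (hp j).ne'
    simp only [r]
    field_simp
    linear_combination -h3
  have hrv : ∀ j, (2 * r j) • a - (2 : ℝ) • b + (r j * (1 + ‖a‖ ^ 2) - (1 + ‖b‖ ^ 2)) • v j = 0 := by
    intro j
    have h3 : w j = 0 := by simpa using hw j
    have hpj := (hp j).ne'
    have h4 : (2 * r j) • a - (2 : ℝ) • b + (r j * (1 + ‖a‖ ^ 2) - (1 + ‖b‖ ^ 2)) • v j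
        = (1 / den a (v j)) • w j := by
      simp only [w, r, smul_add, smul_sub, smul_smul]
      congr 2
      · congr 1; ring
      · congr 1; field_simp
      · field_simp
    rw [h4, h3, smul_zero]
  obtain ⟨j, k, hjk, hrjk⟩ : ∃ j k, j ≠ k ∧ r j = r k := by
    rcases pigeon _ _ _ _ _ _ (by positivity) (hr ⟨0, by omega⟩) (hr ⟨1, by omega⟩)
      (hr ⟨2, by omega⟩) with h | h | h
    · exact ⟨_, _, by simp, h⟩
    · exact ⟨_, _, by simp, h⟩
    · exact ⟨_, _, by simp, h⟩
  have hj := hrv j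
  have hk := hrv k
  rw [← hrjk] at hk
  have hrpos : 0 < r j := div_pos (hq j) (hp j)
  set ρ := r j
  have h5 : (ρ * (1 + ‖a‖ ^ 2) - (1 + ‖b‖ ^ 2)) • (v j - v k) = 0 := by
    rw [smul_sub, sub_eq_zero]
    exact add_left_cancel (hj.trans hk.symm)
  rcases smul_eq_zero.1 h5 with h6 | h6
  · rw [h6, zero_smul, add_zero, mul_smul, ← smul_sub] at hj
    have h7 : ρ • a = b := sub_eq_zero.1 ((smul_eq_zero.1 hj).resolve_left two_ne_zero)
    have h8 : ‖b‖ = ρ * ‖a‖ := by rw [← h7, norm_smul, Real.norm_of_nonneg hrpos.le]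
    have h9 : (ρ - 1) * (1 - ρ * ‖a‖ ^ 2) = 0 := by
      rw [h8] at h6; linear_combination h6
    rcases mul_eq_zero.1 h9 with h10 | h10
    · rw [← h7, sub_eq_zero.1 h10, one_smul]
    · have : ‖a‖ * ‖b‖ < 1 := by nlinarith [norm_nonneg a, norm_nonneg b]
      rw [h8] at this
      nlinarith
  · exact absurd (hinj (sub_eq_zero.1 h6)) hjk

/-- The potential. -/
noncomputable def pot {n : ℕ} (v : Fin n → E) (a : E) : ℝ :=
  ∑ j, Real.log (den a (v j)) - n * Real.log (1 - ‖a‖ ^ 2)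

theorem pot_big {n : ℕ} (hn : 3 ≤ n) (v : Fin n → E) (hv : ∀ j, ‖v j‖ = 1)
    (hinj : Function.Injective v) :
    ∃ δ > 0, ∀ a : E, ‖a‖ < 1 → 1 - ‖a‖ ^ 2 < δ → 0 < pot v a := by
  obtain ⟨m, hm0, hm⟩ : ∃ m : ℝ, 0 < m ∧ ∀ j k, j ≠ k → 2 * m ≤ ‖v j - v k‖ := by
    have : ∀ᶠ m : ℝ in nhdsWithin 0 (Set.Ioi 0), ∀ j k, j ≠ k → 2 * m ≤ ‖v j - v k‖ := by
      rw [Filter.eventually_all]; intro j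
      rw [Filter.eventually_all]; intro k
      by_cases hjk : j = k
      · simp [hjk]
      · have : 0 < ‖v j - v k‖ := norm_pos_iff.2 (sub_ne_zero.2 (hinj.ne hjk))
        have h2 : Set.Ioo (0 : ℝ) (‖v j - v k‖ / 2) ∈ nhdsWithin (0 : ℝ) (Set.Ioi 0) :=
          Ioo_mem_nhdsGT (by positivity)
        filter_upwards [h2] with m hm _
        linarith [hm.2]
    obtain ⟨m, h1, h2⟩ := (this.and self_mem_nhdsWithin).exists
    exact ⟨m, h2, h1⟩
  set M := Real.log (m ^ 2)
  refine ⟨Real.exp ((n - 1) * M - Real.log 4), Real.exp_pos _, fun a ha hδ => ?_⟩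
  have hA : 0 < 1 - ‖a‖ ^ 2 := by nlinarith [norm_nonneg a]
  have hlA := (Real.log_lt_iff_lt_exp hA).2 hδ
  have hlA0 : Real.log (1 - ‖a‖ ^ 2) ≤ 0 := Real.log_nonpos hA.le (by nlinarith [sq_nonneg ‖a‖])
  set l := Real.log (1 - ‖a‖ ^ 2)
  have hlow : ∀ j, 2 * l - Real.log 4 ≤ Real.log (den a (v j)) := by
    intro j
    have h1 := le_norm_add a (v j) (hv j)
    have h2 : 2 * l - Real.log 4 = Real.log ((1 - ‖a‖ ^ 2) ^ 2 / 4) := by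
      rw [Real.log_div (by positivity) (by norm_num), Real.log_pow]; simp [l]
    rw [h2, den_eq _ _ (hv j)]
    apply Real.log_le_log (by positivity)
    have h3 : (1 - ‖a‖ ^ 2) / 2 ≤ ‖a + v j‖ := by nlinarith [norm_nonneg a]
    nlinarith
  obtain ⟨j0, hj0⟩ : ∃ j0, ∀ j, j ≠ j0 → M ≤ Real.log (den a (v j)) := by
    have key : ∀ j, m ≤ ‖a + v j‖ → M ≤ Real.log (den a (v j)) := by
      intro j hj
      rw [den_eq _ _ (hv j)]
      apply Real.log_le_log (by positivity)
      gcongr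
    by_cases hex : ∃ j0, ‖a + v j0‖ < m
    · obtain ⟨j0, h0⟩ := hex
      refine ⟨j0, fun j hj => key j ?_⟩
      have h1 := hm j j0 hj
      have h2 := norm_sub_le (a + v j) (a + v j0)
      rw [add_sub_add_left_eq_sub] at h2
      linarith
    · push Not at hex
      exact ⟨⟨0, by omega⟩, fun j _ => key j (hex j)⟩
  have hs : (2 * l - Real.log 4) + (n - 1) * M ≤ ∑ j, Real.log (den a (v j)) := by
    rw [← Finset.add_sum_erase _ _ (Finset.mem_univ j0)]
    refine add_le_add (hlow j0) ?_
    have := Finset.card_nsmul_le_sum (Finset.univ.erase j0) (fun j => Real.log (den a (v j))) M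
      (fun j hj => hj0 j (Finset.ne_of_mem_erase hj))
    rw [Finset.card_erase_of_mem (Finset.mem_univ _), Finset.card_univ, Fintype.card_fin,
      nsmul_eq_mul, Nat.cast_sub (by omega)] at this
    simpa using this
  have hn' : (3 : ℝ) ≤ n := by exact_mod_cast hn
  have : pot v a = ∑ j, Real.log (den a (v j)) - n * l := rfl
  rw [this]
  nlinarith

theorem exists_min [FiniteDimensional ℝ E] {n : ℕ} (hn : 3 ≤ n) (v : Fin n → E)
    (hv : ∀ j, ‖v j‖ = 1) (hinj : Function.Injective v) :
    ∃ a : E, ‖a‖ < 1 ∧ ∀ b : E, ‖b‖ < 1 → pot v a ≤ pot v b := by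
  obtain ⟨δ, hδ, hbig⟩ := pot_big hn v hv hinj
  have hpot0 : pot v (0 : E) = 0 := by simp [pot, den]
  have hδ1 : δ ≤ 1 := by
    by_contra! h
    have := hbig 0 (by simp) (by simpa using h)
    rw [hpot0] at this
    exact lt_irrefl _ this
  have hlt : ∀ a ∈ Metric.closedBall (0 : E) (√(1 - δ)), ‖a‖ ^ 2 ≤ 1 - δ := by
    intro a ha
    rw [mem_closedBall_zero_iff] at ha
    exact (Real.le_sqrt (norm_nonneg _) (by linarith)).1 ha
  have hlt1 : ∀ a ∈ Metric.closedBall (0 : E) (√(1 - δ)), ‖a‖ < 1 := by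
    intro a ha
    have := hlt a ha
    nlinarith [norm_nonneg a]
  have hcont : ContinuousOn (pot v) (Metric.closedBall (0 : E) (√(1 - δ))) := by
    unfold pot
    refine ContinuousOn.sub (continuousOn_finsetSum _ fun j _ => ContinuousOn.log ?_ ?_)
      (continuousOn_const.mul (ContinuousOn.log ?_ ?_))
    · unfold den; fun_prop
    · intro a ha; exact (den_pos a (v j) (hv j) (hlt1 a ha)).ne'
    · fun_prop
    · intro a ha; have := hlt a ha; linarith
  obtain ⟨a, ha, hmin⟩ := (isCompact_closedBall (0 : E) (√(1 - δ))).exists_isMinOn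
    ⟨0, by simp⟩ hcont
  refine ⟨a, hlt1 a ha, fun b hb => ?_⟩
  by_cases hbm : b ∈ Metric.closedBall (0 : E) (√(1 - δ))
  · exact hmin hbm
  · have h0 : pot v a ≤ pot v 0 := hmin (by simp)
    rw [hpot0] at h0
    refine h0.trans (hbig b hb ?_).le
    rw [mem_closedBall_zero_iff, Real.le_sqrt (norm_nonneg _) (by linarith)] at hbm
    linarith

theorem crit_of_min {n : ℕ} (v : Fin n → E) (hv : ∀ j, ‖v j‖ = 1) (a : E) (ha : ‖a‖ < 1)
    (hmin : ∀ b : E, ‖b‖ < 1 → pot v a ≤ pot v b) (u : E) :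
    ∑ j, ((2 + 2 * ⟪a, v j⟫) * ⟪a, u⟫ + (1 - ‖a‖ ^ 2) * ⟪v j, u⟫) / den a (v j) = 0 := by
  have hA : 0 < 1 - ‖a‖ ^ 2 := by nlinarith [norm_nonneg a]
  have hn2 : HasDerivAt (fun t : ℝ => ‖a + t • u‖ ^ 2) (2 * ⟪a, u⟫) 0 := by
    have h1 : HasDerivAt (fun t : ℝ => a + t • u) u 0 := by
      simpa using ((hasDerivAt_id (0 : ℝ)).smul_const u).const_add a
    simpa using h1.norm_sq
  have hd : ∀ j, HasDerivAt (fun t : ℝ => den (a + t • u) (v j))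
      (2 * ⟪u, v j⟫ + 2 * ⟪a, u⟫) 0 := by
    intro j
    have : (fun t : ℝ => den (a + t • u) (v j)) =
        fun t => 1 + 2 * (⟪a, v j⟫ + t * ⟪u, v j⟫) + ‖a + t • u‖ ^ 2 := by
      funext t; simp [den, inner_add_left, inner_smul_left]
    rw [this]
    refine HasDerivAt.add ?_ hn2
    simpa using ((((hasDerivAt_id (0 : ℝ)).mul_const ⟪u, v j⟫).const_add ⟪a, v j⟫).const_mul
      2).const_add 1
  have hpot : HasDerivAt (fun t : ℝ => pot v (a + t • u))
      (∑ j, (2 * ⟪u, v j⟫ + 2 * ⟪a, u⟫) / den a (v j) - n * (-(2 * ⟪a, u⟫) / (1 - ‖a‖ ^ 2))) 0 := by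
    unfold pot
    refine HasDerivAt.sub (HasDerivAt.fun_sum fun j _ => ?_) (HasDerivAt.const_mul _ ?_)
    · have := (hd j).log (by simpa using (den_pos a (v j) (hv j) ha).ne')
      simpa using this
    · have := (hn2.const_sub 1).log (by simpa using hA.ne')
      simpa using this
  have hloc : IsLocalMin (fun t : ℝ => pot v (a + t • u)) 0 := by
    have hc : Continuous fun t : ℝ => ‖a + t • u‖ := by fun_prop
    have : ∀ᶠ t : ℝ in nhds 0, ‖a + t • u‖ < 1 :=
      hc.continuousAt.eventually_lt continuousAt_const (by simpa using ha)
    filter_upwards [this] with t ht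
    simpa using hmin _ ht
  have h0 := hloc.hasDerivAt_eq_zero hpot
  have e : ∑ j, ((2 + 2 * ⟪a, v j⟫) * ⟪a, u⟫ + (1 - ‖a‖ ^ 2) * ⟪v j, u⟫) / den a (v j)
      = (1 - ‖a‖ ^ 2) / 2 * (∑ j, (2 * ⟪u, v j⟫ + 2 * ⟪a, u⟫) / den a (v j)
        - n * (-(2 * ⟪a, u⟫) / (1 - ‖a‖ ^ 2))) := by
    have : (n : ℝ) * (-(2 * ⟪a, u⟫) / (1 - ‖a‖ ^ 2)) =
      ∑ j : Fin n, (-(2 * ⟪a, u⟫) / (1 - ‖a‖ ^ 2)) := by simp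
    rw [this, ← Finset.sum_sub_distrib, Finset.mul_sum]
    refine Finset.sum_congr rfl fun j _ => ?_
    have hp := (den_pos a (v j) (hv j) ha).ne'
    have hA' := hA.ne'
    rw [real_inner_comm u (v j)]
    field_simp
    rw [den]
    ring
  rw [e, h0, mul_zero]

end aux

theorem tau_sum_iff {d n : ℕ} (v : Fin n → EuclideanSpace ℝ (Fin (d + 1)))
    (a : EuclideanSpace ℝ (Fin (d + 1))) :
    ∑ j : Fin n, tau a (v j) = 0 ↔ ∀ u : EuclideanSpace ℝ (Fin (d + 1)),
      ∑ j, ((2 + 2 * ⟪a, v j⟫) * ⟪a, u⟫ + (1 - ‖a‖ ^ 2) * ⟪v j, u⟫) / den a (v j) = 0 := by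
  have : ∀ u, ∑ j, ((2 + 2 * ⟪a, v j⟫) * ⟪a, u⟫ + (1 - ‖a‖ ^ 2) * ⟪v j, u⟫) / den a (v j)
      = ⟪∑ j : Fin n, tau a (v j), u⟫ := by
    intro u
    rw [sum_inner]
    exact Finset.sum_congr rfl fun j _ => (inner_num a (v j) u _).symm
  simp_rw [this]
  constructor
  · intro h u; rw [h, inner_zero_left]
  · intro h; exact inner_self_eq_zero.1 (h _)

/-- Given `n ≥ 3` distinct points on the unit sphere `S^d ⊂ ℝ^{d+1}` (`d ≥ 1`), there is a
unique `a` with `‖a‖ < 1` such that the Möbius transformation `τ_a` moves the points so that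
their barycenter is the center of the sphere. -/
theorem moebius_normalization (d n : ℕ) (hd : 1 ≤ d) (hn : 3 ≤ n)
    (v : Fin n → EuclideanSpace ℝ (Fin (d + 1)))
    (hv : ∀ j, ‖v j‖ = 1) (hinj : Function.Injective v) :
    ∃! a : EuclideanSpace ℝ (Fin (d + 1)),
      ‖a‖ < 1 ∧ ∑ j : Fin n, tau a (v j) = 0 := by
  obtain ⟨a, ha, hmin⟩ := exists_min hn v hv hinj
  have hc := crit_of_min v hv a ha hmin
  refine ⟨a, ⟨ha, (tau_sum_iff v a).2 hc⟩, ?_⟩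
  rintro b ⟨hb, hb2⟩
  exact uniq hn v hv hinj b a hb ha ((tau_sum_iff v b).1 hb2) hc
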